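/- Let p be an odd prime. Then the following identity of formal power series in X with integer coefficients holds: (1−p²X²)(1−p⁴X⁴) · ∑_{n≥0} a_R^{cc}(pⁿ)Xⁿ = 1 + X + (p³−p²)X³ − p³X⁴ − p⁴X⁵. -/

import Mathlib

/-- `R = ℤ[t]/(t⁴)`. -/
abbrev Rt4 : Type := Polynomial ℤ ⧸ Ideal.span ({Polynomial.X ^ 4} : Set (Polynomial ℤ))

/-- `a_R^{cc}(k)`: the number of cocyclic (unital) subrings of `ℤ[t]/(t⁴)` of additive
index `k`, i.e. those whose additive quotient `R/S` is cyclic. -/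
noncomputable def aRcc (k : ℕ) : ℕ :=
  Nat.card {S : Subring Rt4 //
    S.toAddSubgroup.index = k ∧ IsAddCyclic (Rt4 ⧸ S.toAddSubgroup)}

section Counting

open Finset

/-- The multiples of `p ^ k` in `[0, p ^ n)`. -/
def powMultiples (p n k : ℕ) : Finset ℕ := (range (p ^ n)).filter (p ^ k ∣ ·)

lemma card_powMultiples {p n k : ℕ} (hp : p.Prime) (hk : k ≤ n) :
    (powMultiples p n k).card = p ^ (n - k) := by
  have hpos : 0 < p ^ k := pow_pos hp.pos k
  have : powMultiples p n k = (range (p ^ (n - k))).image (p ^ k * ·) := by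
    ext x
    simp only [powMultiples, mem_filter, mem_range, mem_image]
    have hN : p ^ n = p ^ k * p ^ (n - k) := by rw [← pow_add, Nat.add_sub_cancel' hk]
    constructor
    · rintro ⟨hx, y, rfl⟩
      exact ⟨y, by rw [hN] at hx; exact lt_of_mul_lt_mul_left hx hpos.le, rfl⟩
    · rintro ⟨y, hy, rfl⟩
      exact ⟨by rw [hN]; exact Nat.mul_lt_mul_of_pos_left hy hpos, dvd_mul_right _ _⟩
  rw [this, card_image_of_injective _ (fun a b h => Nat.eq_of_mul_eq_mul_left hpos h), card_range]

lemma pow_dvd_mul_iff {p n j b e : ℕ} (hp : p.Prime) (hb : p ^ j ∣ b) (hb' : ¬ p ^ (j + 1) ∣ b) :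
    p ^ n ∣ b * e ↔ p ^ (n - j) ∣ e := by
  have hb0 : b ≠ 0 := by rintro rfl; simp at hb'
  rcases eq_or_ne e 0 with rfl | he
  · simp
  rw [hp.pow_dvd_iff_le_factorization hb0] at hb hb'
  rw [hp.pow_dvd_iff_le_factorization he, hp.pow_dvd_iff_le_factorization (mul_ne_zero hb0 he),
    Nat.factorization_mul hb0 he]
  simp only [Finsupp.add_apply]
  omega

lemma pow_dvd_pow_iff_ceil {p n k e : ℕ} (hp : p.Prime) (hk : k ≠ 0) :
    p ^ n ∣ e ^ k ↔ p ^ (n ⌈/⌉ k) ∣ e := by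
  rcases eq_or_ne e 0 with rfl | he
  · simp [hk]
  rw [hp.pow_dvd_iff_le_factorization he, hp.pow_dvd_iff_le_factorization (pow_ne_zero _ he),
    Nat.factorization_pow, ceilDiv_le_iff_le_mul (Nat.pos_of_ne_zero hk)]
  simp

/-- Pairs `(b, e)` in `[0, p ^ n)` with `p ^ j ∣ b`, `b * e ≡ 0` and `e ^ 2 ≡ 0` modulo `p ^ n`. -/
def nilPairs (p n j : ℕ) : Finset (ℕ × ℕ) :=
  (range (p ^ n) ×ˢ range (p ^ n)).filter
    fun x => p ^ j ∣ x.1 ∧ p ^ n ∣ x.1 * x.2 ∧ p ^ n ∣ x.2 ^ 2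

lemma card_nilPairs_of_ge {p n j : ℕ} (hp : p.Prime) (hj : n / 2 ≤ j) (hjn : j ≤ n) :
    (nilPairs p n j).card = p ^ (n - j) * p ^ (n / 2) := by
  have : nilPairs p n j = powMultiples p n j ×ˢ powMultiples p n (n - n / 2) := by
    ext ⟨b, e⟩
    have hc : n ⌈/⌉ 2 = n - n / 2 := by rw [Nat.ceilDiv_eq_add_pred_div]; omega
    simp only [nilPairs, powMultiples, mem_filter, mem_product, mem_range,
      pow_dvd_pow_iff_ceil hp two_ne_zero, hc]
    have key : p ^ j ∣ b → p ^ (n - n / 2) ∣ e → p ^ n ∣ b * e := fun h1 h2 =>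
      (pow_dvd_pow p (by omega : n ≤ j + (n - n / 2))).trans (pow_add p _ _ ▸ mul_dvd_mul h1 h2)
    tauto
  rw [this, card_product, card_powMultiples hp hjn, card_powMultiples hp (by omega)]
  congr 2
  omega

lemma card_nilPairs_succ {p n j : ℕ} (hp : p.Prime) (hj : j < n / 2) :
    (nilPairs p n j).card = (nilPairs p n (j + 1)).card + (p ^ n - p ^ (n - 1)) := by
  have hle {k : ℕ} (b : ℕ) : p ^ (k + 1) ∣ b → p ^ k ∣ b := (pow_dvd_pow p k.le_succ).trans
  have hsub : nilPairs p n (j + 1) ⊆ nilPairs p n j := by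
    intro x
    simp only [nilPairs, mem_filter]
    exact fun h => ⟨h.1, hle _ h.2.1, h.2.2⟩
  have hsub' : powMultiples p n (j + 1) ⊆ powMultiples p n j := by
    intro x
    simp only [powMultiples, mem_filter]
    exact fun h => ⟨h.1, hle _ h.2⟩
  have hdiff : nilPairs p n j \ nilPairs p n (j + 1) =
      (powMultiples p n j \ powMultiples p n (j + 1)) ×ˢ powMultiples p n (n - j) := by
    ext ⟨b, e⟩
    have hc : n ⌈/⌉ 2 = n - n / 2 := by rw [Nat.ceilDiv_eq_add_pred_div]; omega
    simp only [nilPairs, powMultiples, mem_filter, mem_product, mem_range, mem_sdiff,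
      pow_dvd_pow_iff_ceil hp two_ne_zero, hc]
    have h1 : p ^ (n - j) ∣ e → p ^ (n - n / 2) ∣ e := (pow_dvd_pow p (by omega)).trans
    have h2 := fun h h' => pow_dvd_mul_iff (n := n) (j := j) (b := b) (e := e) hp h h'
    tauto
  rw [← card_sdiff_add_card_eq_card hsub, hdiff, card_product, card_sdiff_of_subset hsub',
    card_powMultiples hp (by omega), card_powMultiples hp (by omega),
    card_powMultiples hp (by omega), Nat.sub_mul, ← pow_add, ← pow_add, add_comm]
  congr 3 <;> omega

lemma card_nilPairs {p n j : ℕ} (hp : p.Prime) (hj : j ≤ n / 2) :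
    (nilPairs p n j).card = p ^ n + (n / 2 - j) * (p ^ n - p ^ (n - 1)) := by
  induction hj using Nat.decreasingInduction with
  | self =>
    rw [card_nilPairs_of_ge hp le_rfl (by omega), ← pow_add]
    simp [Nat.sub_add_cancel (Nat.div_le_self n 2)]
  | of_succ k hk ih =>
    rw [card_nilPairs_succ hp hk, ih, show n / 2 - k = n / 2 - (k + 1) + 1 by omega]
    ring

/-- The equations on `(φ t², φ t³)` under which the kernel of an additive map `φ` with
`φ 1 = 0`, `φ t = 1` is a subring of `ℤ[t]/(t⁴)`. -/
def IsKernelPair {N : ℕ} (x : ZMod N × ZMod N) : Prop :=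
  x.1 ^ 3 = 2 * x.1 * x.2 ∧ x.2 ^ 2 = x.1 ^ 2 * x.2

lemma pow_dvd_of_dvd_mul {p n b e : ℕ} (hp : p.Prime) (h : p ^ n ∣ b * e) :
    p ^ n ∣ b ^ 4 ∨ p ^ n ∣ e ^ 2 := by
  rcases eq_or_ne b 0 with rfl | hb
  · simp
  rcases eq_or_ne e 0 with rfl | he
  · simp
  rw [hp.pow_dvd_iff_le_factorization (mul_ne_zero hb he), Nat.factorization_mul hb he] at h
  rw [hp.pow_dvd_iff_le_factorization (pow_ne_zero _ hb),
    hp.pow_dvd_iff_le_factorization (pow_ne_zero _ he),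
    Nat.factorization_pow, Nat.factorization_pow]
  simp only [Finsupp.add_apply, Finsupp.smul_apply, smul_eq_mul] at h ⊢
  omega

lemma isKernelPair_iff {p n : ℕ} (hp : p.Prime) (hodd : Odd p) (b e : ℕ) (c : ZMod (p ^ n))
    (hc : (e : ZMod (p ^ n)) = 2 * c - (b : ZMod (p ^ n)) ^ 2) :
    IsKernelPair ((b : ZMod (p ^ n)), c) ↔
      p ^ (n ⌈/⌉ 4) ∣ b ∧ p ^ n ∣ b * e ∧ p ^ n ∣ e ^ 2 := by
  have h2 : IsUnit (2 : ZMod (p ^ n)) := by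
    have := (ZMod.isUnit_iff_coprime 2 (p ^ n)).2 (hodd.pow.coprime_two_left)
    exact_mod_cast this
  have h2' {x : ZMod (p ^ n)} : 2 * x = 0 ↔ x = 0 := h2.mul_right_eq_zero
  have key := pow_dvd_of_dvd_mul (n := n) (b := b) (e := e) hp
  rw [← pow_dvd_pow_iff_ceil hp four_ne_zero]
  simp only [← ZMod.natCast_eq_zero_iff, Nat.cast_mul, Nat.cast_pow] at key ⊢
  simp only [IsKernelPair]
  rw [hc] at *
  generalize (b : ZMod (p ^ n)) = b at *
  constructor
  · rintro ⟨h3, h4⟩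
    have hbe : b * (2 * c - b ^ 2) = 0 := by linear_combination -h3
    have heq : (2 * c - b ^ 2) ^ 2 = b ^ 4 := by linear_combination 4 * h4
    rcases key hbe with h | h
    · exact ⟨h, hbe, heq.trans h⟩
    · exact ⟨heq.symm.trans h, hbe, h⟩
  · rintro ⟨h4, hbe, hee⟩
    refine ⟨by linear_combination -hbe, ?_⟩
    rw [← sub_eq_zero, ← h2', ← h2']
    linear_combination hee - h4

lemma card_isKernelPair {p n : ℕ} (hp : p.Prime) (hodd : Odd p) :
    Nat.card {x : ZMod (p ^ n) × ZMod (p ^ n) // IsKernelPair x} =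
      (nilPairs p n (n ⌈/⌉ 4)).card := by
  have : NeZero (p ^ n) := ⟨pow_ne_zero _ hp.ne_zero⟩
  have h2 : IsUnit (2 : ZMod (p ^ n)) := by
    have := (ZMod.isUnit_iff_coprime 2 (p ^ n)).2 (hodd.pow.coprime_two_left)
    exact_mod_cast this
  rw [← Nat.card_eq_finsetCard]
  have hiff := fun (b e : ZMod (p ^ n)) (c : ZMod (p ^ n)) h =>
    isKernelPair_iff hp hodd b.val e.val c (by simpa using h)
  simp only [ZMod.natCast_val, ZMod.cast_id', id] at hiff
  refine Nat.card_eq_of_bijective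
    (fun x => ⟨(x.1.1.val, (2 * x.1.2 - x.1.1 ^ 2).val), ?_⟩) ⟨?_, ?_⟩
  · simp only [nilPairs, mem_filter, mem_product, mem_range, ZMod.val_lt, true_and]
    exact (hiff _ _ x.1.2 rfl).1 x.2
  · rintro ⟨⟨b, c⟩, h⟩ ⟨⟨b', c'⟩, h'⟩ heq
    simp only [Subtype.mk.injEq, Prod.mk.injEq, (ZMod.val_injective _).eq_iff] at heq ⊢
    obtain ⟨rfl, hc⟩ := heq
    exact ⟨rfl, h2.mul_left_cancel (sub_left_injective hc)⟩
  · rintro ⟨⟨b, e⟩, h⟩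
    simp only [nilPairs, mem_filter, mem_product, mem_range] at h
    obtain ⟨c, hc⟩ := h2.dvd (a := (e : ZMod (p ^ n)) + (b : ZMod (p ^ n)) ^ 2)
    refine ⟨⟨(b, c), (isKernelPair_iff hp hodd b e c (by linear_combination hc)).2 h.2⟩, ?_⟩
    have hc' : 2 * c - (b : ZMod (p ^ n)) ^ 2 = e := by linear_combination -hc
    simp only [hc', ZMod.val_natCast_of_lt h.1.1, ZMod.val_natCast_of_lt h.1.2]

end Counting

namespace Rt4

/-- The class of `t`. -/
noncomputable def t : Rt4 := Ideal.Quotient.mk _ Polynomial.X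

/-- The coefficient of `t ^ i`. -/
noncomputable def coeff (i : Fin 4) : Rt4 →+ ℤ :=
  QuotientAddGroup.lift
    (Submodule.toAddSubgroup (Ideal.span ({Polynomial.X ^ 4} : Set (Polynomial ℤ))))
    (Polynomial.lcoeff ℤ i).toAddMonoidHom (by
      intro f hf
      have := Polynomial.X_pow_dvd_iff.1 (Ideal.mem_span_singleton.1 hf) i i.2
      simpa using this)

lemma coeff_mk (i : Fin 4) (f : Polynomial ℤ) :
    coeff i (Ideal.Quotient.mk _ f) = f.coeff i := rfl

lemma t_pow_four : t ^ 4 = 0 := by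
  rw [t, ← map_pow, Ideal.Quotient.eq_zero_iff_mem]
  exact Ideal.mem_span_singleton_self _

lemma eq_sum (x : Rt4) : x = coeff 0 x • (1 : Rt4) + coeff 1 x • t + coeff 2 x • t ^ 2 +
    coeff 3 x • t ^ 3 := by
  obtain ⟨f, rfl⟩ := Ideal.Quotient.mk_surjective x
  simp only [coeff_mk, t]
  simp only [← map_pow, ← map_zsmul, ← map_add, ← map_one (Ideal.Quotient.mk _)]
  rw [Ideal.Quotient.eq, Ideal.mem_span_singleton, Polynomial.X_pow_dvd_iff]
  intro d hd
  interval_cases d <;>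
    simp [-zsmul_eq_mul, -zsmul_one, Polynomial.coeff_X, Polynomial.coeff_one, Polynomial.coeff_X_pow]

lemma coeff_one (i : Fin 4) : coeff i 1 = if i = 0 then 1 else 0 := by
  rw [← map_one (Ideal.Quotient.mk _), coeff_mk, Polynomial.coeff_one]
  fin_cases i <;> simp

lemma coeff_t_pow (i : Fin 4) (k : ℕ) : coeff i (t ^ k) = if (i : ℕ) = k then 1 else 0 := by
  rw [t, ← map_pow, coeff_mk, Polynomial.coeff_X_pow]

lemma coeff_mul (i : Fin 4) (x y : Rt4) : coeff i (x * y) =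
    ∑ j ∈ Finset.HasAntidiagonal.antidiagonal (i : ℕ),
      coeff (Fin.ofNat 4 j.1) x * coeff (Fin.ofNat 4 j.2) y := by
  obtain ⟨f, rfl⟩ := Ideal.Quotient.mk_surjective x
  obtain ⟨g, rfl⟩ := Ideal.Quotient.mk_surjective y
  rw [← map_mul]
  simp only [coeff_mk, Polynomial.coeff_mul]
  refine Finset.sum_congr rfl fun j hj => ?_
  have := Finset.HasAntidiagonal.mem_antidiagonal.1 hj
  have h1 : j.1 % 4 = j.1 := Nat.mod_eq_of_lt (by omega)
  have h2 : j.2 % 4 = j.2 := Nat.mod_eq_of_lt (by omega)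
  simp [Fin.ofNat, h1, h2]

variable {N : ℕ}

lemma map_zsmul_eq_mul (f : Rt4 →+ ZMod N) (k : ℤ) (r : Rt4) : f (k • r) = k * f r := by
  rw [map_zsmul, zsmul_eq_mul]

/-- The additive map with `1 ↦ 0`, `t ↦ 1`, `t² ↦ b`, `t³ ↦ c`. -/
noncomputable def functional (x : ZMod N × ZMod N) : Rt4 →+ ZMod N :=
  let cast := Int.castAddHom (ZMod N)
  cast.comp (coeff 1) + (AddMonoidHom.mulLeft x.1).comp (cast.comp (coeff 2)) +
    (AddMonoidHom.mulLeft x.2).comp (cast.comp (coeff 3))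

lemma functional_apply (x : ZMod N × ZMod N) (r : Rt4) :
    functional x r = coeff 1 r + x.1 * coeff 2 r + x.2 * coeff 3 r := rfl

lemma functional_one (x : ZMod N × ZMod N) : functional x 1 = 0 := by
  simp [functional_apply, coeff_one]

lemma functional_t (x : ZMod N × ZMod N) : functional x t = 1 := by
  have h (i : Fin 4) := coeff_t_pow i 1
  simp only [pow_one] at h
  simp [functional_apply, h]

lemma functional_t_sq (x : ZMod N × ZMod N) : functional x (t ^ 2) = x.1 := by
  simp [functional_apply, coeff_t_pow]

lemma functional_t_cube (x : ZMod N × ZMod N) : functional x (t ^ 3) = x.2 := by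
  simp [functional_apply, coeff_t_pow]

lemma functional_surjective (x : ZMod N × ZMod N) : Function.Surjective (functional x) := by
  intro y
  obtain ⟨k, rfl⟩ := ZMod.intCast_surjective y
  exact ⟨k • t, by simp [-zsmul_eq_mul, map_zsmul_eq_mul, functional_t]⟩

lemma coeff_one_mul (x y : Rt4) : coeff 1 (x * y) =
    coeff 0 x * coeff 1 y + coeff 1 x * coeff 0 y :=
  (coeff_mul 1 x y).trans (by simp [Finset.Nat.antidiagonal_succ, Fin.ofNat])

lemma coeff_two_mul (x y : Rt4) : coeff 2 (x * y) =
    coeff 0 x * coeff 2 y + coeff 1 x * coeff 1 y + coeff 2 x * coeff 0 y :=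
  (coeff_mul 2 x y).trans (by simp [Finset.Nat.antidiagonal_succ, Fin.ofNat, add_assoc])

lemma coeff_three_mul (x y : Rt4) : coeff 3 (x * y) =
    coeff 0 x * coeff 3 y + coeff 1 x * coeff 2 y + coeff 2 x * coeff 1 y +
      coeff 3 x * coeff 0 y :=
  (coeff_mul 3 x y).trans (by simp [Finset.Nat.antidiagonal_succ, Fin.ofNat, add_assoc])

lemma functional_mul {x : ZMod N × ZMod N} (hx : IsKernelPair x) {r s : Rt4}
    (hr : functional x r = 0) (hs : functional x s = 0) : functional x (r * s) = 0 := by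
  obtain ⟨b, c⟩ := x
  obtain ⟨h1, h2⟩ := hx
  have h3 : b * c ^ 2 = 0 := by linear_combination (-c) * h1 - b * h2
  simp only [functional_apply, coeff_one_mul, coeff_two_mul, coeff_three_mul] at *
  push_cast
  linear_combination ((coeff 0 r : ℤ) + (-(b * (coeff 2 r : ℤ) + c * (coeff 3 r : ℤ)) * b +
    c * (coeff 2 r : ℤ))) * hs + ((coeff 0 s : ℤ) + b * (coeff 1 s : ℤ) +
    c * (coeff 2 s : ℤ)) * hr + (coeff 2 r : ℤ) * (coeff 2 s : ℤ) * h1 -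
    ((coeff 2 r : ℤ) * (coeff 3 s : ℤ) + (coeff 3 r : ℤ) * (coeff 2 s : ℤ)) * h2 +
    (coeff 3 r : ℤ) * (coeff 3 s : ℤ) * h3

/-- The subring cut out by a pair satisfying `IsKernelPair`. -/
noncomputable def kernelSubring (x : ZMod N × ZMod N) (hx : IsKernelPair x) : Subring Rt4 where
  __ := (functional x).ker
  one_mem' := functional_one x
  mul_mem' := functional_mul hx

lemma toAddSubgroup_kernelSubring (x : ZMod N × ZMod N) (hx : IsKernelPair x) :
    (kernelSubring x hx).toAddSubgroup = (functional x).ker := rfl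

lemma mem_kernelSubring {x : ZMod N × ZMod N} {hx : IsKernelPair x} {r : Rt4} :
    r ∈ kernelSubring x hx ↔ functional x r = 0 := Iff.rfl

lemma index_kernelSubring (x : ZMod N × ZMod N) (hx : IsKernelPair x) :
    (kernelSubring x hx).toAddSubgroup.index = N := by
  rw [toAddSubgroup_kernelSubring, AddSubgroup.index_ker,
    AddMonoidHom.range_eq_top.2 (functional_surjective x)]
  simp

lemma isAddCyclic_quotient_kernelSubring (x : ZMod N × ZMod N) (hx : IsKernelPair x) :
    IsAddCyclic (Rt4 ⧸ (kernelSubring x hx).toAddSubgroup) := by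
  rw [toAddSubgroup_kernelSubring]
  exact isAddCyclic_of_injective
    (QuotientAddGroup.quotientKerEquivOfSurjective _ (functional_surjective x)).toAddMonoidHom
    (AddEquiv.injective _)

lemma kernelSubring_injective {x y : ZMod N × ZMod N} {hx : IsKernelPair x} {hy : IsKernelPair y}
    (h : kernelSubring x hx = kernelSubring y hy) : x = y := by
  have key (r : Rt4) (z : ZMod N) (hz : functional x r = z) : functional y r = z := by
    obtain ⟨k, rfl⟩ := ZMod.intCast_surjective z
    have : r - k • t ∈ kernelSubring x hx := by
      simp [-zsmul_eq_mul, map_zsmul_eq_mul, mem_kernelSubring, functional_t, hz]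
    rw [h, mem_kernelSubring] at this
    simpa [-zsmul_eq_mul, map_zsmul_eq_mul, functional_t, sub_eq_zero] using this
  ext
  · rw [← key _ _ (functional_t_sq x), functional_t_sq]
  · rw [← key _ _ (functional_t_cube x), functional_t_cube]

lemma apply_eq (f : Rt4 →+ ZMod N) (h1 : f 1 = 0) (r : Rt4) :
    f r = coeff 1 r * f t + coeff 2 r * f (t ^ 2) + coeff 3 r * f (t ^ 3) := by
  conv_lhs => rw [eq_sum r]
  simp [-zsmul_eq_mul, -zsmul_one, map_zsmul_eq_mul, h1]

/-- The relations between the values on `t, t², t³` of an additive map whose kernel is a subring. -/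
lemma relations_of_ker_mul (f : Rt4 →+ ZMod N)
    (hmul : ∀ r s, f r = 0 → f s = 0 → f (r * s) = 0) :
    f (t ^ 2) ^ 3 = 2 * f t * f (t ^ 2) * f (t ^ 3) ∧
      f t * f (t ^ 3) ^ 2 = f (t ^ 2) ^ 2 * f (t ^ 3) ∧ f (t ^ 3) ^ 3 = 0 := by
  obtain ⟨a, ha⟩ := ZMod.intCast_surjective (f t)
  obtain ⟨b, hb⟩ := ZMod.intCast_surjective (f (t ^ 2))
  obtain ⟨c, hc⟩ := ZMod.intCast_surjective (f (t ^ 3))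
  have hu : f (b • t - a • t ^ 2) = 0 := by
    simp [-zsmul_eq_mul, map_zsmul_eq_mul, ← ha, ← hb, mul_comm]
  have hv : f (c • t - a • t ^ 3) = 0 := by
    simp [-zsmul_eq_mul, map_zsmul_eq_mul, ← ha, ← hc, mul_comm]
  have hw : f (c • t ^ 2 - b • t ^ 3) = 0 := by
    simp [-zsmul_eq_mul, map_zsmul_eq_mul, ← hb, ← hc, mul_comm]
  have huu := hmul _ _ hu hu
  have huv := hmul _ _ hu hv
  have hvw := hmul _ _ hv hw
  have t4 := t_pow_four
  rw [show (b • t - a • t ^ 2) * (b • t - a • t ^ 2) = (b ^ 2) • t ^ 2 - (2 * a * b) • t ^ 3 by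
    simp only [zsmul_eq_mul]; push_cast; linear_combination (a : Rt4) ^ 2 * t4] at huu
  rw [show (b • t - a • t ^ 2) * (c • t - a • t ^ 3) = (b * c) • t ^ 2 - (a * c) • t ^ 3 by
    simp only [zsmul_eq_mul]; push_cast
    linear_combination ((a : Rt4) ^ 2 * t - a * b) * t4] at huv
  rw [show (c • t - a • t ^ 3) * (c • t ^ 2 - b • t ^ 3) = (c ^ 2) • t ^ 3 by
    simp only [zsmul_eq_mul]; push_cast
    linear_combination ((a : Rt4) * b * t ^ 2 - a * c * t - b * c) * t4] at hvw
  simp only [map_sub, map_zsmul_eq_mul, ← hb, ← hc, ← ha] at huu huv hvw ⊢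
  push_cast at huu huv hvw
  exact ⟨by linear_combination huu, by linear_combination -huv, by linear_combination hvw⟩

lemma exists_eq_kernelSubring [NeZero N] {S : Subring Rt4} (hS : S.toAddSubgroup.index = N)
    (hcyc : IsAddCyclic (Rt4 ⧸ S.toAddSubgroup)) :
    ∃ (x : ZMod N × ZMod N) (hx : IsKernelPair x), kernelSubring x hx = S := by
  obtain ⟨f, hf, hsurj⟩ : ∃ f : Rt4 →+ ZMod N, (∀ r, f r = 0 ↔ r ∈ S) ∧ Function.Surjective f := by
    subst hS
    let e : ZMod S.toAddSubgroup.index ≃+ Rt4 ⧸ S.toAddSubgroup := zmodAddCyclicAddEquiv hcyc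
    refine ⟨e.symm.toAddMonoidHom.comp (QuotientAddGroup.mk' S.toAddSubgroup), fun r => ?_,
      e.symm.surjective.comp (QuotientAddGroup.mk'_surjective _)⟩
    change e.symm (r : Rt4 ⧸ S.toAddSubgroup) = 0 ↔ _
    rw [EmbeddingLike.map_eq_zero_iff, QuotientAddGroup.eq_zero_iff]
    rfl
  have h1 : f 1 = 0 := (hf 1).2 S.one_mem
  obtain ⟨hb, hc, hc3⟩ := relations_of_ker_mul f fun r s hr hs =>
    (hf _).2 (S.mul_mem ((hf r).1 hr) ((hf s).1 hs))
  have hcnil : IsNilpotent (f (t ^ 3)) := ⟨3, hc3⟩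
  have hbnil : IsNilpotent (f (t ^ 2)) := by
    refine ⟨3 * 3, ?_⟩
    rw [pow_mul, hb]
    linear_combination 8 * f t ^ 3 * f (t ^ 2) ^ 3 * hc3
  have hunit : IsUnit (f t) := by
    obtain ⟨r, hr⟩ := hsurj 1
    rw [apply_eq f h1 r] at hr
    have hnil : IsNilpotent (coeff 2 r * f (t ^ 2) + coeff 3 r * f (t ^ 3)) :=
      (Commute.all _ _).isNilpotent_add ((Commute.all _ _).isNilpotent_mul_left hbnil)
        ((Commute.all _ _).isNilpotent_mul_left hcnil)
    have := hnil.isUnit_one_sub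
    rw [show (1 : ZMod N) - (coeff 2 r * f (t ^ 2) + coeff 3 r * f (t ^ 3)) = coeff 1 r * f t by
      rw [← hr]; ring] at this
    exact isUnit_of_mul_isUnit_right this
  obtain ⟨u, hu⟩ := hunit.exists_left_inv
  refine ⟨(u * f (t ^ 2), u * f (t ^ 3)), ⟨?_, ?_⟩, ?_⟩
  · linear_combination u ^ 3 * hb + 2 * u ^ 2 * f (t ^ 2) * f (t ^ 3) * hu
  · linear_combination u ^ 3 * hc - u ^ 2 * f (t ^ 3) ^ 2 * hu
  · ext r
    have : functional (u * f (t ^ 2), u * f (t ^ 3)) r = u * f r := by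
      rw [apply_eq f h1 r, functional_apply]
      linear_combination -(coeff 1 r : ZMod N) * hu
    refine mem_kernelSubring.trans ?_
    rw [this, ← hf, (IsUnit.of_mul_eq_one _ hu).mul_right_eq_zero]

end Rt4

lemma aRcc_eq_card_isKernelPair (N : ℕ) [NeZero N] :
    aRcc N = Nat.card {x : ZMod N × ZMod N // IsKernelPair x} := by
  refine (Nat.card_eq_of_bijective
    (fun x => ⟨Rt4.kernelSubring x.1 x.2, Rt4.index_kernelSubring x.1 x.2,
      Rt4.isAddCyclic_quotient_kernelSubring x.1 x.2⟩) ⟨?_, ?_⟩).symm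
  · exact fun x y h => Subtype.ext (Rt4.kernelSubring_injective (hx := x.2) (hy := y.2) (congrArg Subtype.val h))
  · rintro ⟨S, hS, hcyc⟩
    obtain ⟨x, hx, rfl⟩ := Rt4.exists_eq_kernelSubring hS hcyc
    exact ⟨⟨x, hx⟩, rfl⟩

lemma aRcc_prime_pow {p : ℕ} (hp : p.Prime) (hodd : Odd p) (n : ℕ) :
    aRcc (p ^ n) = (nilPairs p n (n ⌈/⌉ 4)).card := by
  have : NeZero (p ^ n) := ⟨pow_ne_zero _ hp.ne_zero⟩
  rw [aRcc_eq_card_isKernelPair, card_isKernelPair hp hodd]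

lemma aRcc_prime {p : ℕ} (hp : p.Prime) (hodd : Odd p) : aRcc (p ^ 1) = 1 := by
  rw [aRcc_prime_pow hp hodd, show 1 ⌈/⌉ 4 = 1 from rfl, card_nilPairs_of_ge hp] <;> simp

lemma aRcc_prime_pow_eq {p : ℕ} (hp : p.Prime) (hodd : Odd p) {n : ℕ} (hn : n ≠ 1) :
    (aRcc (p ^ n) : ℤ) =
      p ^ n + ((n / 2 - (n + 3) / 4 : ℕ) : ℤ) * ((p : ℤ) ^ n - (p : ℤ) ^ (n - 1)) := by
  have hc : n ⌈/⌉ 4 = (n + 3) / 4 := Nat.ceilDiv_eq_add_pred_div ..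
  rw [aRcc_prime_pow hp hodd, hc, card_nilPairs hp (by omega)]
  push_cast [Nat.cast_sub (Nat.pow_le_pow_right hp.pos (Nat.sub_le n 1))]
  rfl

open PowerSeries in
lemma mul_mk_eq_of_coeff_eq (p : ℕ) (f : ℕ → ℤ) (h1 : f 1 = 1)
    (hf : ∀ n, n ≠ 1 → f n =
      p ^ n + ((n / 2 - (n + 3) / 4 : ℕ) : ℤ) * ((p : ℤ) ^ n - (p : ℤ) ^ (n - 1))) :
    (1 - (p : PowerSeries ℤ)^2 * X^2) * (1 - (p : PowerSeries ℤ)^4 * X^4) * PowerSeries.mk f =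
      1 + X + ((p : PowerSeries ℤ)^3 - (p : PowerSeries ℤ)^2) * X^3
        - (p : PowerSeries ℤ)^3 * X^4 - (p : PowerSeries ℤ)^4 * X^5 := by
  ext n
  have hcast : (p : PowerSeries ℤ) = C (p : ℤ) := (map_natCast (C (R := ℤ)) p).symm
  have hexp (F : PowerSeries ℤ) :
      (1 - (p : PowerSeries ℤ) ^ 2 * X ^ 2) * (1 - (p : PowerSeries ℤ) ^ 4 * X ^ 4) * F =
        F - C ((p : ℤ) ^ 2) * (X ^ 2 * F) - C ((p : ℤ) ^ 4) * (X ^ 4 * F) +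
          C ((p : ℤ) ^ 6) * (X ^ 6 * F) := by
    simp only [map_pow, ← hcast]
    ring
  rw [hexp, hcast]
  simp only [← map_pow, sub_mul, map_add, map_sub, coeff_C_mul, coeff_X_pow_mul', coeff_mk, coeff_X_pow, coeff_X,
    coeff_one]
  obtain hn | ⟨k, rfl⟩ : n < 8 ∨ ∃ k, n = k + 8 := by
    rcases lt_or_ge n 8 with h | h
    · exact Or.inl h
    · exact Or.inr ⟨n - 8, by omega⟩
  · have e0 := hf 0 (by decide)
    have e2 := hf 2 (by decide)
    have e3 := hf 3 (by decide)
    have e4 := hf 4 (by decide)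
    have e5 := hf 5 (by decide)
    have e6 := hf 6 (by decide)
    have e7 := hf 7 (by decide)
    norm_num at e0 e2 e3 e4 e5 e6 e7
    interval_cases n <;> simp [h1, e0, e2, e3, e4, e5, e6, e7] <;> ring
  · have e2 := hf (k + 2) (by omega)
    have e4 := hf (k + 4) (by omega)
    have e6 := hf (k + 6) (by omega)
    have e8 := hf (k + 8) (by omega)
    rw [show (k + 6) / 2 - (k + 6 + 3) / 4 = ((k + 2) / 2 - (k + 2 + 3) / 4) + 1 by omega] at e6
    rw [show (k + 8) / 2 - (k + 8 + 3) / 4 = ((k + 4) / 2 - (k + 4 + 3) / 4) + 1 by omega] at e8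
    simp only [show k + 8 - 2 = k + 6 by omega, show k + 8 - 4 = k + 4 by omega,
      show k + 8 - 6 = k + 2 by omega, show 2 ≤ k + 8 by omega, show 4 ≤ k + 8 by omega,
      show 6 ≤ k + 8 by omega, show k + 8 ≠ 0 by omega, show k + 8 ≠ 1 by omega,
      show k + 8 ≠ 3 by omega, show k + 8 ≠ 4 by omega, show k + 8 ≠ 5 by omega, if_true, if_false,
      e2, e4, e6, e8]
    simp only [show k + 8 - 1 = k + 7 by omega, show k + 6 - 1 = k + 5 by omega,
      show k + 4 - 1 = k + 3 by omega, show k + 2 - 1 = k + 1 by omega]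
    push_cast
    ring

open PowerSeries in
/-- For an odd prime `p`,
`(1−p²X²)(1−p⁴X⁴) · ∑ₙ a_R^{cc}(pⁿ)Xⁿ = 1 + X + (p³−p²)X³ − p³X⁴ − p⁴X⁵`. -/
theorem stmt_3 (p : ℕ) (hp : p.Prime) (hodd : Odd p) :
    (1 - (p : PowerSeries ℤ)^2 * X^2) * (1 - (p : PowerSeries ℤ)^4 * X^4) *
        (PowerSeries.mk fun n => (aRcc (p ^ n) : ℤ)) =
      1 + X + ((p : PowerSeries ℤ)^3 - (p : PowerSeries ℤ)^2) * X^3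
        - (p : PowerSeries ℤ)^3 * X^4 - (p : PowerSeries ℤ)^4 * X^5 := by
  exact mul_mk_eq_of_coeff_eq p _ (by exact_mod_cast aRcc_prime hp hodd)
    fun n hn => aRcc_prime_pow_eq hp hodd hn
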